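/- Let (X_i)_{i=1}^𝔪 be a sequence of infinite-dimensional separable purely atomic Banach lattices satisfying (⋆) for the same constant μ, let 𝐞 be a 1-unconditional basis with 𝔪 terms, and let X := (⊕_i X_i)_𝐞 (such X is order complete, so ℒʳ(X) is a Banach lattice algebra). Let (x_i) be a shrinking basis for X satisfying (⋆) with constant μ in each summand, with biorthogonal functionals (x_i*), q_i := x_i*⊗x_i and e_n := ∑_{i=1}^n q_i. Let e := id_X and let 𝔛 be a Banach lattice ℒʳ(X)-module such that sup_n e_n·x′ = e·x′ and sup_n x′·e_n = x′·e for all x′ ∈ 𝔛′₊. Suppose further that either 𝔛 contains no complemented subspace isomorphic to ℓ₁, or X is reflexive and dim(q_i·𝔛′·q_j) < ∞ for all i, j ∈ ℕ. Then every bounded derivation D : ℒʳ(X) → 𝔛′ is regular. -/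

import Mathlib

/- STATEMENT 5 (Corollary cor1): every bounded derivation from ℒʳ(X) into the dual
   of a Banach lattice ℒʳ(X)-module 𝔛 is regular, provided sup_n e_n·x′ = e·x′,
   sup_n x′·e_n = x′·e on 𝔛′₊ and either 𝔛 has no complemented copy of ℓ₁, or X is
   reflexive and the corner spaces q_i·𝔛′·q_j are finite dimensional. -/

open Filter Topology

section Prelude

variable {X 𝔛 : Type*} [NormedAddCommGroup X] [Lattice X] [HasSolidNorm X] [IsOrderedAddMonoid X] [NormedSpace ℝ X]
variable [NormedAddCommGroup 𝔛] [Lattice 𝔛] [HasSolidNorm 𝔛] [IsOrderedAddMonoid 𝔛] [NormedSpace ℝ 𝔛]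

/-- A bounded operator is positive if it maps the positive cone into itself. -/
def IsPosOp (T : X →L[ℝ] X) : Prop := ∀ x : X, 0 ≤ x → 0 ≤ T x

/-- The operator order on regular operators. -/
def opLe (S T : X →L[ℝ] X) : Prop := IsPosOp (T - S)

/-- ℒʳ(X): the regular operators, i.e. linear combinations of positive operators. -/
def LrSet (X : Type*) [NormedAddCommGroup X] [Lattice X] [HasSolidNorm X] [IsOrderedAddMonoid X] [NormedSpace ℝ X] :
    Set (X →L[ℝ] X) :=
  {T | ∃ (n : ℕ) (c : Fin n → ℝ) (S : Fin n → X →L[ℝ] X),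
    (∀ i, IsPosOp (S i)) ∧ T = ∑ i, c i • S i}

/-- The regular norm ‖T‖ᵣ = inf{‖S‖ : |Tx| ≤ S|x| for all x}. -/
noncomputable def rnorm (T : X →L[ℝ] X) : ℝ :=
  sInf {c : ℝ | ∃ S : X →L[ℝ] X, ‖S‖ = c ∧ ∀ x : X, |T x| ≤ S |x|}

/-- ℱ(X): continuous finite-rank operators. -/
def FinRankOp (T : X →L[ℝ] X) : Prop :=
  ∃ (n : ℕ) (f : Fin n → X →L[ℝ] ℝ) (v : Fin n → X), T = ∑ i, (f i).smulRight (v i)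

/-- 𝒜ʳ(X): the ‖·‖ᵣ-closure of ℱ(X) in ℒʳ(X). -/
def ArSet (X : Type*) [NormedAddCommGroup X] [Lattice X] [HasSolidNorm X] [IsOrderedAddMonoid X] [NormedSpace ℝ X] :
    Set (X →L[ℝ] X) :=
  {T | T ∈ LrSet X ∧ ∀ ε : ℝ, 0 < ε → ∃ F : X →L[ℝ] X, FinRankOp F ∧ rnorm (T - F) < ε}

/-- x is a normalized atom of the Banach lattice X. -/
def IsNormAtom (a : X) : Prop :=
  0 < a ∧ ‖a‖ = 1 ∧ ∀ y : X, 0 ≤ y → y ≤ a → ∃ c : ℝ, y = c • a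

/-- The dual (pointwise-on-the-cone) order on 𝔛′ = 𝔛 →L[ℝ] ℝ. -/
def dualLe (f g : 𝔛 →L[ℝ] ℝ) : Prop := ∀ y : 𝔛, 0 ≤ y → f y ≤ g y

/-- Least upper bound with respect to the dual order. -/
def dualIsLUB (S : Set (𝔛 →L[ℝ] ℝ)) (f : 𝔛 →L[ℝ] ℝ) : Prop :=
  (∀ g ∈ S, dualLe g f) ∧ ∀ h : 𝔛 →L[ℝ] ℝ, (∀ g ∈ S, dualLe g h) → dualLe f h

/-- A subset of the dual is weak*-closed. -/
def wstarClosed (S : Set (𝔛 →L[ℝ] ℝ)) : Prop :=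
  IsClosed (StrongDual.toWeakDual '' S)

/-- (y i)_{i<n} and (z i)_{i<n} are L-equivalent. -/
def seqEquivUpTo (L : ℝ) (n : ℕ) (y z : ℕ → X) : Prop :=
  ∀ α : ℕ → ℝ,
    ‖∑ i ∈ Finset.range n, α i • y i‖ ≤ L * ‖∑ i ∈ Finset.range n, α i • z i‖ ∧
    ‖∑ i ∈ Finset.range n, α i • z i‖ ≤ L * ‖∑ i ∈ Finset.range n, α i • y i‖

/-- The sequence (x i) satisfies the selection property (⋆) with constant μ. -/
def StarSeq (μ : ℝ) (x : ℕ → X) : Prop :=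
  ∃ μs : ℕ → ℝ, (∀ n, 1 ≤ μs n ∧ μs n ≤ μ) ∧
    ∀ (n : ℕ) (l : ℕ → ℕ), 0 < n → (∀ i j, i < j → j < n → l i < l j) →
      seqEquivUpTo (μs n) n x (fun i => x (l i)) →
      ∀ k : ℕ, ∃ m : ℕ, l (n - 1) + k ≤ m ∧
        seqEquivUpTo (μs (n + 1)) (n + 1) x (fun i => x (Function.update l n m i))

/-- (x i) is (an enumeration of the normalized atoms of X forming) a basis for
X = (⊕_n X_n)_𝐞 satisfying (⋆) with constant μ in each summand: there is a partition
of ℕ into slices (ψ n ·), n ∈ I, order preserving on each slice, such that on each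
slice the (⋆)-property holds with constant μ, the slices are pairwise disjoint
sublattices, and the decomposition into slices is 1-unconditional. -/
def StarSummandBasis (μ : ℝ) (x : ℕ → X) : Prop :=
  ∃ (I : Set ℕ) (ψ : ℕ → ℕ → ℕ),
    (∀ n ∈ I, StrictMono (ψ n)) ∧
    (∀ i : ℕ, ∃! p : ℕ × ℕ, p.1 ∈ I ∧ ψ p.1 p.2 = i) ∧
    (∀ n ∈ I, StarSeq μ (fun j => x (ψ n j))) ∧
    (∀ i, IsNormAtom (x i)) ∧
    (∀ a : X, IsNormAtom a → ∃ i, x i = a) ∧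
    (∀ n ∈ I, ∀ m ∈ I, n ≠ m → ∀ j j' : ℕ, x (ψ n j) ⊓ x (ψ m j') = 0) ∧
    (∀ (s : Finset ℕ) (α ε : ℕ → ℝ),
      (∀ n ∈ I, ∀ j j' : ℕ, ε (ψ n j) = ε (ψ n j')) → (∀ i, |ε i| ≤ 1) →
      ‖∑ i ∈ s, (ε i * α i) • x i‖ ≤ ‖∑ i ∈ s, α i • x i‖)

/-- A sequence in the dual is equivalent to the unit vector basis of c₀. -/
def EquivC0Basis (ξ : ℕ → (𝔛 →L[ℝ] ℝ)) : Prop :=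
  ∃ L : ℝ, 0 < L ∧ ∀ (m : ℕ) (α : ℕ → ℝ),
    (∀ j < m, |α j| ≤ L * ‖∑ i ∈ Finset.range m, α i • ξ i‖) ∧
    (∀ B : ℝ, 0 ≤ B → (∀ i < m, |α i| ≤ B) →
      ‖∑ i ∈ Finset.range m, α i • ξ i‖ ≤ L * B)

/-- A map D defined (at least) on A ⊆ ℒʳ(X), with values in 𝔛′, is regular if on A it
is a finite linear combination of positive linear maps. -/
def RegularDerivOn (A : Set (X →L[ℝ] X)) (D : (X →L[ℝ] X) → (𝔛 →L[ℝ] ℝ)) : Prop :=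
  ∃ (n : ℕ) (c : Fin n → ℝ) (P : Fin n → (X →L[ℝ] X) → (𝔛 →L[ℝ] ℝ)),
    (∀ t, (∀ a ∈ A, ∀ b ∈ A, P t (a + b) = P t a + P t b) ∧
          (∀ (r : ℝ), ∀ a ∈ A, P t (r • a) = r • P t a) ∧
          (∀ a ∈ A, IsPosOp a → dualLe 0 (P t a))) ∧
    ∀ a ∈ A, D a = ∑ t, c t • P t a

/-- 𝔛 contains a complemented subspace isomorphic to ℓ₁. -/
def HasComplementedL1 (𝔛 : Type*) [NormedAddCommGroup 𝔛] [Lattice 𝔛] [HasSolidNorm 𝔛] [IsOrderedAddMonoid 𝔛] [NormedSpace ℝ 𝔛] :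
    Prop :=
  ∃ (P : 𝔛 →L[ℝ] 𝔛) (e : ℕ → 𝔛) (L : ℝ), 0 < L ∧ P ∘L P = P ∧
    (∀ y : 𝔛, P y ∈ closure (Submodule.span ℝ (Set.range e) : Set 𝔛)) ∧
    (∀ i, P (e i) = e i) ∧
    (∀ (m : ℕ) (α : ℕ → ℝ),
      L⁻¹ * ∑ i ∈ Finset.range m, |α i| ≤ ‖∑ i ∈ Finset.range m, α i • e i‖ ∧
      ‖∑ i ∈ Finset.range m, α i • e i‖ ≤ L * ∑ i ∈ Finset.range m, |α i|)

end Prelude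

set_option linter.unusedSectionVars false

section NormedLattice

variable {V : Type*} [NormedAddCommGroup V] [Lattice V] [HasSolidNorm V] [IsOrderedAddMonoid V]

theorem disjoint_add_right {a b c : V} (hc : 0 ≤ c) (ha : 0 ≤ a) (hb : 0 ≤ b)
    (hab : a ⊓ b = 0) (hac : a ⊓ c = 0) : a ⊓ (b + c) = 0 := by
  refine le_antisymm ?_ (le_inf ha (add_nonneg hb hc))
  have h : a ⊓ (b + c) - b ≤ a ⊓ c :=
    le_inf ((sub_le_self _ hb).trans inf_le_left) (sub_le_iff_le_add'.2 inf_le_right)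
  rw [hac, sub_nonpos] at h
  exact hab ▸ le_inf inf_le_left h

theorem disjoint_sum_right {ι : Type*} (s : Finset ι) {a : V} (b : ι → V) (ha : 0 ≤ a)
    (hb : ∀ i, 0 ≤ b i) (hab : ∀ i ∈ s, a ⊓ b i = 0) : a ⊓ ∑ i ∈ s, b i = 0 := by
  classical
  induction s using Finset.induction_on with
  | empty => simpa using ha
  | insert i s hi ih =>
    rw [Finset.sum_insert hi]
    exact disjoint_add_right (Finset.sum_nonneg fun j _ => hb j) ha (hb i)
      (hab i (Finset.mem_insert_self i s)) (ih fun j hj => hab j (Finset.mem_insert_of_mem hj))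

variable [NormedSpace ℝ V]

theorem half_smul_nonneg {y : V} (hy : 0 ≤ y) : 0 ≤ (2⁻¹ : ℝ) • y := by
  set z := (2⁻¹ : ℝ) • y
  have h : z + z = y := by
    rw [← two_smul ℝ z, smul_smul]; norm_num
  have h' : |z| = z := sup_eq_left.2 (by
    rw [← sub_nonneg, sub_neg_eq_add, h]; exact hy)
  rw [← h']
  exact abs_nonneg z

theorem normedLattice_smul_nonneg {t : ℝ} (ht : 0 ≤ t) {y : V} (hy : 0 ≤ y) : 0 ≤ t • y := by
  have hdy : ∀ k : ℕ, 0 ≤ ((2⁻¹ : ℝ) ^ k) • y := by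
    intro k
    induction k with
    | zero => simpa using hy
    | succ k ih =>
      rw [pow_succ', mul_smul]
      exact half_smul_nonneg ih
  have hlim : Tendsto (fun k : ℕ => ((⌊t * 2 ^ k⌋₊ : ℝ) / 2 ^ k) • y) atTop (𝓝 (t • y)) := by
    refine Tendsto.smul_const ?_ y
    exact (tendsto_nat_floor_mul_div_atTop ht).comp
      (tendsto_pow_atTop_atTop_of_one_lt (one_lt_two : (1 : ℝ) < 2))
  refine ge_of_tendsto' hlim fun k => ?_
  rw [div_eq_mul_inv, mul_smul, ← inv_pow, Nat.cast_smul_eq_nsmul]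
  exact nsmul_nonneg (hdy k) _

theorem normedLattice_smul_le_smul {s t : ℝ} (h : s ≤ t) {y : V} (hy : 0 ≤ y) :
    s • y ≤ t • y := by
  rw [← sub_nonneg, ← sub_smul]
  exact normedLattice_smul_nonneg (sub_nonneg.2 h) hy

theorem abs_smul_of_nonneg_le (t : ℝ) {y : V} (hy : 0 ≤ y) : |t • y| ≤ |t| • y := by
  refine sup_le (normedLattice_smul_le_smul (le_abs_self t) hy) ?_
  rw [← neg_smul]
  exact normedLattice_smul_le_smul (neg_le_abs t) hy

theorem norm_le_norm_of_nonneg_le {a b : V} (ha : 0 ≤ a) (hab : a ≤ b) : ‖a‖ ≤ ‖b‖ :=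
  norm_le_norm_of_abs_le_abs (by rwa [abs_of_nonneg ha, abs_of_nonneg (ha.trans hab)])

theorem norm_posPart_le (y : V) : ‖y⁺‖ ≤ ‖y‖ := by
  rw [← norm_abs_eq_norm y]
  exact norm_le_norm_of_nonneg_le (posPart_nonneg y) (sup_le (le_abs_self y) (abs_nonneg y))

theorem norm_negPart_le (y : V) : ‖y⁻‖ ≤ ‖y‖ := by
  simpa using norm_posPart_le (-y)

theorem lattice_abs_sum_le_sum_abs {ι : Type*} (s : Finset ι) (b : ι → V) :
    |∑ i ∈ s, b i| ≤ ∑ i ∈ s, |b i| := by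
  classical
  induction s using Finset.induction_on with
  | empty => simp
  | insert i s hi ih =>
    rw [Finset.sum_insert hi, Finset.sum_insert hi]
    refine (abs_add_le _ _).trans (add_le_add_right ih _)

theorem abs_apply_le_of_nonneg_bound (f : V →L[ℝ] ℝ) {C : ℝ}
    (h : ∀ y, 0 ≤ y → |f y| ≤ C * ‖y‖) (hC : 0 ≤ C) (y : V) : |f y| ≤ 2 * C * ‖y‖ := by
  have h1 : f y = f y⁺ - f y⁻ := by rw [← map_sub, posPart_sub_negPart]
  have h2 := (h _ (posPart_nonneg y)).trans (mul_le_mul_of_nonneg_left (norm_posPart_le y) hC)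
  have h3 := (h _ (negPart_nonneg y)).trans (mul_le_mul_of_nonneg_left (norm_negPart_le y) hC)
  rw [h1]
  linarith [abs_sub (f y⁺) (f y⁻)]

/-- The positive part of a bounded functional, given by the Riesz-Kantorovich formula. -/
theorem exists_functional_posPart (f : V →L[ℝ] ℝ) :
    ∃ g : V →L[ℝ] ℝ, dualLe 0 g ∧ dualLe f g ∧
      ∀ y, 0 ≤ y → ∀ ε > 0, ∃ w, 0 ≤ w ∧ w ≤ y ∧ g y ≤ f w + ε := by
  set p : V → ℝ := fun y => sSup (f '' Set.Icc 0 y) with hp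
  have hbd : ∀ y, ∀ r ∈ f '' Set.Icc 0 y, r ≤ ‖f‖ * ‖y‖ := by
    rintro y _ ⟨w, hw, rfl⟩
    exact (le_abs_self _).trans ((f.le_opNorm w).trans
      (mul_le_mul_of_nonneg_left (norm_le_norm_of_nonneg_le hw.1 hw.2) (norm_nonneg f)))
  have hbdd : ∀ y, BddAbove (f '' Set.Icc 0 y) := fun y => ⟨_, hbd y⟩
  have hne : ∀ y : V, 0 ≤ y → (f '' Set.Icc 0 y).Nonempty := fun y hy =>
    ⟨f 0, 0, ⟨le_rfl, hy⟩, rfl⟩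
  have hle : ∀ y w : V, 0 ≤ w → w ≤ y → f w ≤ p y := fun y w h1 h2 =>
    le_csSup (hbdd y) ⟨w, ⟨h1, h2⟩, rfl⟩
  have hp0 : ∀ y : V, 0 ≤ y → 0 ≤ p y := fun y hy => by simpa using hle y 0 le_rfl hy
  have hple : ∀ y : V, 0 ≤ y → p y ≤ ‖f‖ * ‖y‖ := fun y hy => csSup_le (hne y hy) (hbd y)
  have happrox : ∀ y : V, 0 ≤ y → ∀ ε > 0, ∃ w, 0 ≤ w ∧ w ≤ y ∧ p y ≤ f w + ε := by
    intro y hy ε hε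
    obtain ⟨_, ⟨w, hw, rfl⟩, h⟩ := exists_lt_of_lt_csSup (hne y hy) (sub_lt_self (p y) hε)
    exact ⟨w, hw.1, hw.2, by linarith⟩
  have hadd : ∀ u v : V, 0 ≤ u → 0 ≤ v → p (u + v) = p u + p v := by
    intro u v hu hv
    apply le_antisymm
    · refine csSup_le (hne _ (add_nonneg hu hv)) ?_
      rintro _ ⟨w, ⟨hw0, hw⟩, rfl⟩
      have h1 : f (w ⊓ u) ≤ p u := hle _ _ (le_inf hw0 hu) inf_le_right
      have h2 : f (w - w ⊓ u) ≤ p v := by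
        refine hle _ _ (sub_nonneg.2 inf_le_left) ?_
        rw [sub_le_iff_le_add, add_inf]
        exact le_inf (le_add_of_nonneg_left hv) (by rwa [add_comm v u])
      rw [map_sub] at h2
      linarith
    · refine le_of_forall_pos_le_add fun ε hε => ?_
      obtain ⟨w, hw0, hw, h⟩ := happrox u hu (ε / 2) (half_pos hε)
      obtain ⟨w', hw0', hw', h'⟩ := happrox v hv (ε / 2) (half_pos hε)
      have := hle (u + v) (w + w') (add_nonneg hw0 hw0') (add_le_add hw hw')
      rw [map_add] at this
      linarith
  have hdiff : ∀ u v u' v' : V, 0 ≤ u → 0 ≤ v → 0 ≤ u' → 0 ≤ v' → u - v = u' - v' →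
      p u - p v = p u' - p v' := by
    intro u v u' v' hu hv hu' hv' h
    have : p (u + v') = p (u' + v) := by rw [sub_eq_sub_iff_add_eq_add.1 h]
    rw [hadd _ _ hu hv', hadd _ _ hu' hv] at this
    linarith
  let G : V →+ ℝ :=
    { toFun := fun y => p y⁺ - p y⁻
      map_zero' := by simp
      map_add' := fun u v => by
        have := hdiff (u + v)⁺ (u + v)⁻ (u⁺ + v⁺) (u⁻ + v⁻) (posPart_nonneg _) (negPart_nonneg _)
          (add_nonneg (posPart_nonneg _) (posPart_nonneg _))
          (add_nonneg (negPart_nonneg _) (negPart_nonneg _)) (by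
            rw [posPart_sub_negPart, add_sub_add_comm, posPart_sub_negPart, posPart_sub_negPart])
        rw [this, hadd _ _ (posPart_nonneg _) (posPart_nonneg _),
          hadd _ _ (negPart_nonneg _) (negPart_nonneg _)]
        ring }
  have hG : ∀ y, 0 ≤ y → G y = p y := fun y hy => by
    change p y⁺ - p y⁻ = p y
    rw [posPart_eq_self.2 hy, negPart_eq_zero.2 hy]
    have : p 0 = 0 := by have := hadd 0 0 le_rfl le_rfl; rw [add_zero] at this; linarith
    rw [this, sub_zero]
  have hGc : Continuous G := by
    refine AddMonoidHomClass.continuous_of_bound G ‖f‖ fun y => ?_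
    have h1 := (hple _ (posPart_nonneg y)).trans
      (mul_le_mul_of_nonneg_left (norm_posPart_le y) (norm_nonneg f))
    have h2 := (hple _ (negPart_nonneg y)).trans
      (mul_le_mul_of_nonneg_left (norm_negPart_le y) (norm_nonneg f))
    have h3 := hp0 _ (posPart_nonneg y)
    have h4 := hp0 _ (negPart_nonneg y)
    change ‖p y⁺ - p y⁻‖ ≤ _
    rw [Real.norm_eq_abs, abs_le]
    constructor <;> linarith
  refine ⟨G.toRealLinearMap hGc, fun y hy => ?_, fun y hy => ?_, fun y hy ε hε => ?_⟩
  · simpa [hG y hy] using hp0 y hy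
  · simpa [hG y hy] using hle y y hy le_rfl
  · simpa [hG y hy] using happrox y hy ε hε

theorem exists_weak_limit {ι : Type*} (U : Ultrafilter ι) (F : ι → V →L[ℝ] ℝ) {C : ℝ}
    (h : ∀ i y, |F i y| ≤ C * ‖y‖) :
    ∃ G : V →L[ℝ] ℝ, ∀ y, Tendsto (fun i => F i y) U (𝓝 (G y)) := by
  have hlim : ∀ y, ∃ r, Tendsto (fun i => F i y) U (𝓝 r) := by
    intro y
    obtain ⟨r, -, hr⟩ := (isCompact_Icc (a := -(C * ‖y‖)) (b := C * ‖y‖)).ultrafilter_le_nhds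
      (U.map fun i => F i y) (by
        simp only [Ultrafilter.coe_map, le_principal_iff, mem_map]
        exact Filter.univ_mem' fun i => abs_le.1 (h i y))
    exact ⟨r, hr⟩
  choose g hg using hlim
  have hgl : Tendsto (fun i y => (F i : V →ₗ[ℝ] ℝ) y) U (𝓝 g) := tendsto_pi_nhds.2 hg
  refine ⟨(linearMapOfTendsto g (fun i => (F i : V →ₗ[ℝ] ℝ)) hgl).mkContinuous C fun y => ?_,
    fun y => ?_⟩
  · refine le_of_tendsto (hg y).abs ?_
    exact Filter.Eventually.of_forall fun i => h i y
  · simpa using hg y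

theorem eq_of_eq_on_nonneg {f g : V →L[ℝ] ℝ} (h : ∀ y, 0 ≤ y → f y = g y) : f = g := by
  ext y
  rw [← posPart_sub_negPart y, map_sub, map_sub, h _ (posPart_nonneg y), h _ (negPart_nonneg y)]

theorem tendsto_of_monotone_dualIsLUB (U : Ultrafilter ℕ) (hU : (U : Filter ℕ) ≤ atTop)
    (F : ℕ → V →L[ℝ] ℝ) (G : V →L[ℝ] ℝ) {C : ℝ} (hb : ∀ n y, |F n y| ≤ C * ‖y‖)
    (hmono : ∀ n m, n ≤ m → dualLe (F n) (F m)) (hG : dualIsLUB (Set.range F) G) (y : V) :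
    Tendsto (fun n => F n y) U (𝓝 (G y)) := by
  obtain ⟨H, hH⟩ := exists_weak_limit U F hb
  have h1 : dualLe G H := hG.2 H (by
    rintro _ ⟨n, rfl⟩ z hz
    exact ge_of_tendsto (hH z) (hU ((eventually_ge_atTop n).mono fun m hm => hmono n m hm z hz)))
  have h2 : dualLe H G := fun z hz =>
    le_of_tendsto' (hH z) fun n => hG.1 _ ⟨n, rfl⟩ z hz
  rw [eq_of_eq_on_nonneg fun z hz => le_antisymm (h1 z hz) (h2 z hz)]
  exact hH y

end NormedLattice

section RegularOperators

variable {X : Type*} [NormedAddCommGroup X] [Lattice X] [HasSolidNorm X] [IsOrderedAddMonoid X]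
  [NormedSpace ℝ X]

theorem IsPosOp.add {S T : X →L[ℝ] X} (hS : IsPosOp S) (hT : IsPosOp T) : IsPosOp (S + T) :=
  fun y hy => add_nonneg (hS y hy) (hT y hy)

theorem IsPosOp.smul {S : X →L[ℝ] X} (hS : IsPosOp S) {t : ℝ} (ht : 0 ≤ t) : IsPosOp (t • S) :=
  fun y hy => normedLattice_smul_nonneg ht (hS y hy)

theorem IsPosOp.comp {S T : X →L[ℝ] X} (hS : IsPosOp S) (hT : IsPosOp T) : IsPosOp (S ∘L T) :=
  fun y hy => hS _ (hT y hy)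

theorem isPosOp_zero : IsPosOp (0 : X →L[ℝ] X) := fun _ _ => le_rfl

theorem isPosOp_id : IsPosOp (ContinuousLinearMap.id ℝ X) := fun _ hy => hy

theorem isPosOp_sum {ι : Type*} (s : Finset ι) {S : ι → X →L[ℝ] X} (h : ∀ i ∈ s, IsPosOp (S i)) :
    IsPosOp (∑ i ∈ s, S i) := fun y hy => by
  rw [sum_apply]
  exact Finset.sum_nonneg fun i hi => h i hi y hy

theorem mem_LrSet_iff {T : X →L[ℝ] X} :
    T ∈ LrSet X ↔ ∃ P Q : X →L[ℝ] X, IsPosOp P ∧ IsPosOp Q ∧ T = P - Q := by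
  constructor
  · rintro ⟨n, c, S, hS, rfl⟩
    refine ⟨∑ i, (c i)⁺ • S i, ∑ i, (c i)⁻ • S i,
      isPosOp_sum _ fun i _ => (hS i).smul (posPart_nonneg _),
      isPosOp_sum _ fun i _ => (hS i).smul (negPart_nonneg _), ?_⟩
    rw [← Finset.sum_sub_distrib]
    refine Finset.sum_congr rfl fun i _ => ?_
    rw [← sub_smul, posPart_sub_negPart]
  · rintro ⟨P, Q, hP, hQ, rfl⟩
    refine ⟨2, ![1, -1], ![P, Q], fun i => ?_, ?_⟩
    · fin_cases i
      exacts [hP, hQ]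
    · simp [Fin.sum_univ_two, sub_eq_add_neg]

theorem IsPosOp.mem_LrSet {S : X →L[ℝ] X} (hS : IsPosOp S) : S ∈ LrSet X :=
  mem_LrSet_iff.2 ⟨S, 0, hS, isPosOp_zero, (sub_zero S).symm⟩

variable (X) in
/-- The algebra ℒʳ(X) of regular operators. -/
def LrAlg : Subalgebra ℝ (X →L[ℝ] X) where
  carrier := LrSet X
  mul_mem' := by
    intro a b ha hb
    obtain ⟨P, Q, hP, hQ, rfl⟩ := mem_LrSet_iff.1 ha
    obtain ⟨P', Q', hP', hQ', rfl⟩ := mem_LrSet_iff.1 hb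
    refine mem_LrSet_iff.2 ⟨P * P' + Q * Q', P * Q' + Q * P', (hP.comp hP').add (hQ.comp hQ'),
      (hP.comp hQ').add (hQ.comp hP'), ?_⟩
    noncomm_ring
  add_mem' := by
    intro a b ha hb
    obtain ⟨P, Q, hP, hQ, rfl⟩ := mem_LrSet_iff.1 ha
    obtain ⟨P', Q', hP', hQ', rfl⟩ := mem_LrSet_iff.1 hb
    exact mem_LrSet_iff.2 ⟨P + P', Q + Q', hP.add hP', hQ.add hQ', by abel⟩
  algebraMap_mem' := by
    intro r
    refine mem_LrSet_iff.2 ⟨r⁺ • 1, r⁻ • 1, isPosOp_id.smul (posPart_nonneg r),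
      isPosOp_id.smul (negPart_nonneg r), ?_⟩
    rw [← sub_smul, posPart_sub_negPart, Algebra.algebraMap_eq_smul_one]

theorem rnorm_le_norm {T S : X →L[ℝ] X} (h : ∀ y, |T y| ≤ S |y|) : rnorm T ≤ ‖S‖ :=
  csInf_le ⟨0, by rintro _ ⟨R, rfl, -⟩; exact norm_nonneg R⟩ ⟨S, rfl, h⟩

theorem rnorm_nonneg (T : X →L[ℝ] X) : 0 ≤ rnorm T :=
  Real.sInf_nonneg (by rintro _ ⟨R, rfl, -⟩; exact norm_nonneg R)

end RegularOperators

section AtomicBasis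

variable {X : Type*} [NormedAddCommGroup X] [Lattice X] [HasSolidNorm X] [IsOrderedAddMonoid X]
  [NormedSpace ℝ X] {x : ℕ → X} {xs : ℕ → X →L[ℝ] ℝ}

theorem inf_eq_zero_of_isNormAtom (hx : ∀ i, IsNormAtom (x i))
    (hbi : ∀ i j, xs i (x j) = if i = j then (1 : ℝ) else 0) {i j : ℕ} (hij : i ≠ j) :
    x i ⊓ x j = 0 := by
  have h0 : 0 ≤ x i ⊓ x j := le_inf (hx i).1.le (hx j).1.le
  obtain ⟨c, hc⟩ := (hx i).2.2 _ h0 inf_le_left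
  obtain ⟨d, hd⟩ := (hx j).2.2 _ h0 inf_le_right
  have h : xs i (c • x i) = xs i (d • x j) := by rw [← hc, ← hd]
  simp only [map_smul, hbi, if_true, if_neg hij, smul_eq_mul, mul_one, mul_zero] at h
  rw [hc, h, zero_smul]

theorem inf_abs_smul_eq_zero (hx : ∀ i, IsNormAtom (x i))
    (hbi : ∀ i j, xs i (x j) = if i = j then (1 : ℝ) else 0) {i j : ℕ} (hij : i ≠ j) (t : ℝ) :
    x i ⊓ |t • x j| = 0 := by
  obtain ⟨n, hn⟩ := exists_nat_ge |t|
  have h1 : |t • x j| ≤ ∑ _k ∈ Finset.range n, x j := by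
    refine (abs_smul_of_nonneg_le t (hx j).1.le).trans ?_
    rw [Finset.sum_const, Finset.card_range, ← Nat.cast_smul_eq_nsmul ℝ]
    exact normedLattice_smul_le_smul hn (hx j).1.le
  refine le_antisymm ((inf_le_inf_left _ h1).trans_eq ?_) (le_inf (hx i).1.le (abs_nonneg _))
  exact disjoint_sum_right _ _ (hx i).1.le (fun _ => (hx j).1.le)
    fun _ _ => inf_eq_zero_of_isNormAtom hx hbi hij

theorem coord_nonneg (hx : ∀ i, IsNormAtom (x i))
    (hbi : ∀ i j, xs i (x j) = if i = j then (1 : ℝ) else 0)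
    (hbasis : ∀ y : X, Tendsto (fun n => ∑ i ∈ Finset.range n, xs i y • x i) atTop (𝓝 y))
    (i : ℕ) {y : X} (hy : 0 ≤ y) : 0 ≤ xs i y := by
  by_contra! hneg
  set t := -xs i y with ht
  have htpos : 0 < t := by linarith
  have hdisj : ∀ N, i < N →
      x i ⊓ |(∑ j ∈ Finset.range N, xs j y • x j) + t • x i| = 0 := by
    intro N hN
    have h1 : (∑ j ∈ Finset.range N, xs j y • x j) + t • x i
        = ∑ j ∈ (Finset.range N).erase i, xs j y • x j := by
      rw [← Finset.add_sum_erase _ _ (Finset.mem_range.2 hN), ht, neg_smul]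
      abel
    rw [h1]
    refine le_antisymm ((inf_le_inf_left _ (lattice_abs_sum_le_sum_abs _ _)).trans_eq ?_)
      (le_inf (hx i).1.le (abs_nonneg _))
    exact disjoint_sum_right _ _ (hx i).1.le (fun _ => abs_nonneg _)
      fun j hj => inf_abs_smul_eq_zero hx hbi (Finset.ne_of_mem_erase hj).symm _
  have hc : Continuous fun z : X => x i ⊓ |z + t • x i| := by
    have : Continuous fun z : X => x i ⊓ ((z + t • x i) ⊔ -(z + t • x i)) := by fun_prop
    exact this
  have hlim : x i ⊓ |y + t • x i| = 0 :=
    tendsto_nhds_unique ((hc.tendsto y).comp (hbasis y))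
      (tendsto_const_nhds.congr' ((eventually_gt_atTop i).mono fun N hN => (hdisj N hN).symm))
  have hle : min t 1 • x i ≤ x i ⊓ |y + t • x i| := by
    refine le_inf ?_ ?_
    · simpa using normedLattice_smul_le_smul (min_le_right t 1) (hx i).1.le
    · refine (normedLattice_smul_le_smul (min_le_left t 1) (hx i).1.le).trans ?_
      exact (le_add_of_nonneg_left hy).trans (le_abs_self _)
  rw [hlim] at hle
  have h0 : min t 1 • x i = 0 :=
    le_antisymm hle (normedLattice_smul_nonneg (le_min htpos.le zero_le_one) (hx i).1.le)
  rcases smul_eq_zero.1 h0 with h | h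
  · exact (lt_min htpos zero_lt_one).ne' h
  · exact (hx i).1.ne' h

/-- The matrix unit `xs j ⊗ x i`. -/
noncomputable def matUnit (x : ℕ → X) (xs : ℕ → X →L[ℝ] ℝ) (i j : ℕ) : X →L[ℝ] X :=
  (xs j).smulRight (x i)

theorem isPosOp_matUnit (hx : ∀ i, IsNormAtom (x i))
    (hbi : ∀ i j, xs i (x j) = if i = j then (1 : ℝ) else 0)
    (hbasis : ∀ y : X, Tendsto (fun n => ∑ i ∈ Finset.range n, xs i y • x i) atTop (𝓝 y))
    (i j : ℕ) : IsPosOp (matUnit x xs i j) := fun _ hy =>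
  normedLattice_smul_nonneg (coord_nonneg hx hbi hbasis j hy) (hx i).1.le

theorem matUnit_comp (a : X →L[ℝ] X) (i j k l : ℕ) :
    matUnit x xs i j * (a * matUnit x xs k l) = xs j (a (x k)) • matUnit x xs i l := by
  ext y
  simp [matUnit, smul_smul, mul_comm]

theorem partialSum_le (hx : ∀ i, IsNormAtom (x i))
    (hbi : ∀ i j, xs i (x j) = if i = j then (1 : ℝ) else 0)
    (hbasis : ∀ y : X, Tendsto (fun n => ∑ i ∈ Finset.range n, xs i y • x i) atTop (𝓝 y))
    (n : ℕ) {y : X} (hy : 0 ≤ y) : (∑ i ∈ Finset.range n, matUnit x xs i i) y ≤ y := by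
  refine ge_of_tendsto (hbasis y) ((eventually_ge_atTop n).mono fun N hN => ?_)
  rw [sum_apply]
  exact Finset.sum_le_sum_of_subset_of_nonneg (Finset.range_subset_range.2 hN)
    fun i _ _ => isPosOp_matUnit hx hbi hbasis i i y hy

theorem rnorm_signed_sum_le (hx : ∀ i, IsNormAtom (x i))
    (hbi : ∀ i j, xs i (x j) = if i = j then (1 : ℝ) else 0)
    (hbasis : ∀ y : X, Tendsto (fun n => ∑ i ∈ Finset.range n, xs i y • x i) atTop (𝓝 y))
    (n : ℕ) (ε : ℕ → ℝ) (hε : ∀ i, |ε i| ≤ 1) :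
    rnorm (∑ i ∈ Finset.range n, ε i • matUnit x xs i i) ≤ 1 := by
  refine (rnorm_le_norm (S := ContinuousLinearMap.id ℝ X) fun y => ?_).trans
    ContinuousLinearMap.norm_id_le
  refine le_trans ?_ (partialSum_le hx hbi hbasis n (abs_nonneg y))
  rw [sum_apply, sum_apply]
  refine (lattice_abs_sum_le_sum_abs _ _).trans (Finset.sum_le_sum fun i _ => ?_)
  change |ε i • xs i y • x i| ≤ xs i |y| • x i
  rw [smul_smul]
  refine (abs_smul_of_nonneg_le _ (hx i).1.le).trans
    (normedLattice_smul_le_smul ?_ (hx i).1.le)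
  have hpos := fun {z : X} (hz : 0 ≤ z) => coord_nonneg hx hbi hbasis i hz
  have h1 : |xs i y| ≤ xs i |y| := by
    refine abs_le.2 ⟨?_, ?_⟩
    · have := hpos (sub_nonneg.2 (neg_le_abs y))
      rw [map_sub, map_neg] at this
      linarith
    · have := hpos (sub_nonneg.2 (le_abs_self y))
      rw [map_sub] at this
      linarith
  rw [abs_mul]
  calc |ε i| * |xs i y| ≤ 1 * |xs i y| := by gcongr; exact hε i
    _ ≤ xs i |y| := by rwa [one_mul]

end AtomicBasis

section Derivation

/-- Some choice of signs makes the off-diagonal part of a quadratic form nonnegative. -/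
theorem exists_signs_sum_diag_le {ι : Type*} (s : Finset ι) (β : ι → ι → ℝ) :
    ∃ ε : ι → ℝ, (∀ i, ε i = 1 ∨ ε i = -1) ∧
      ∑ i ∈ s, β i i ≤ ∑ i ∈ s, ∑ j ∈ s, ε i * ε j * β i j := by
  classical
  induction s using Finset.induction_on with
  | empty => exact ⟨fun _ => 1, fun _ => Or.inl rfl, by simp⟩
  | insert k s hk ih =>
    obtain ⟨ε, hε, h⟩ := ih
    set t := ∑ j ∈ s, ε j * (β k j + β j k) with ht
    obtain ⟨σ, hσ, hσt⟩ : ∃ σ : ℝ, (σ = 1 ∨ σ = -1) ∧ 0 ≤ σ * t := by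
      rcases le_total 0 t with h0 | h0
      · exact ⟨1, Or.inl rfl, by simpa using h0⟩
      · exact ⟨-1, Or.inr rfl, by simpa using h0⟩
    have hne : ∀ i ∈ s, Function.update ε k σ i = ε i := fun i hi =>
      Function.update_of_ne (by rintro rfl; exact hk hi) _ _
    refine ⟨Function.update ε k σ, fun i => ?_, ?_⟩
    · by_cases hi : i = k
      · subst hi; simpa using hσ
      · rw [Function.update_of_ne hi]; exact hε i
    · rw [Finset.sum_insert hk, Finset.sum_insert hk, Finset.sum_insert hk]
      have h1 : ∑ i ∈ s, ∑ j ∈ insert k s,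
          Function.update ε k σ i * Function.update ε k σ j * β i j
          = ∑ i ∈ s, ε i * σ * β i k + ∑ i ∈ s, ∑ j ∈ s, ε i * ε j * β i j := by
        rw [← Finset.sum_add_distrib]
        refine Finset.sum_congr rfl fun i hi => ?_
        rw [Finset.sum_insert hk, hne i hi, Function.update_self]
        congr 1
        exact Finset.sum_congr rfl fun j hj => by rw [hne j hj]
      have h2 : ∑ j ∈ s, Function.update ε k σ k * Function.update ε k σ j * β k j
          = ∑ j ∈ s, σ * ε j * β k j :=
        Finset.sum_congr rfl fun j hj => by rw [hne j hj, Function.update_self]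
      have h3 : σ * t = ∑ j ∈ s, σ * ε j * β k j + ∑ i ∈ s, ε i * σ * β i k := by
        rw [ht, Finset.mul_sum, ← Finset.sum_add_distrib]
        exact Finset.sum_congr rfl fun j _ => by ring
      have h4 : σ * σ = 1 := by rcases hσ with rfl | rfl <;> norm_num
      rw [h1, h2, Function.update_self, h4]
      linarith

variable {X V : Type*} [NormedAddCommGroup X] [Lattice X] [HasSolidNorm X]
  [IsOrderedAddMonoid X] [NormedSpace ℝ X]
  [NormedAddCommGroup V] [Lattice V] [HasSolidNorm V] [IsOrderedAddMonoid V] [NormedSpace ℝ V]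

/-- `V` is a Banach lattice ℒʳ(X)-module with left and right actions `l` and `r`. -/
structure IsLrModule (l r : LrAlg X →ₗ[ℝ] V →L[ℝ] V) (K : ℝ) : Prop where
  l_mul : ∀ a b y, l (a * b) y = l a (l b y)
  r_mul : ∀ a b y, r (a * b) y = r b (r a y)
  l_r : ∀ a b y, l a (r b y) = r b (l a y)
  l_nonneg : ∀ a : LrAlg X, IsPosOp (a : X →L[ℝ] X) → ∀ y, 0 ≤ y → 0 ≤ l a y
  r_nonneg : ∀ a : LrAlg X, IsPosOp (a : X →L[ℝ] X) → ∀ y, 0 ≤ y → 0 ≤ r a y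
  norm_l_le : ∀ a y, ‖l a y‖ ≤ K * rnorm (a : X →L[ℝ] X) * ‖y‖
  norm_r_le : ∀ a y, ‖r a y‖ ≤ K * rnorm (a : X →L[ℝ] X) * ‖y‖
  nonneg : 0 ≤ K

/-- `D` is a bounded derivation into the dual module. -/
structure IsDualDerivation (l r : LrAlg X →ₗ[ℝ] V →L[ℝ] V) (D : LrAlg X →ₗ[ℝ] V →L[ℝ] ℝ) :
    Prop where
  map_mul : ∀ a b y, D (a * b) y = D b (r a y) + D a (l b y)
  bound : ∃ C, 0 ≤ C ∧ ∀ a y, |D a y| ≤ C * rnorm (a : X →L[ℝ] X) * ‖y‖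

/-- Positive matrix units in ℒʳ(X) with coefficient functionals `c` and uniformly bounded signed
diagonal sums. -/
structure IsMatrixUnits (E : ℕ → ℕ → LrAlg X) (c : ℕ → ℕ → LrAlg X →ₗ[ℝ] ℝ) : Prop where
  pos : ∀ i j, IsPosOp (E i j : X →L[ℝ] X)
  coeff : ∀ i j a, E i i * (a * E j j) = c i j a • E i j
  coeff_nonneg : ∀ i j (a : LrAlg X), IsPosOp (a : X →L[ℝ] X) → 0 ≤ c i j a
  coeff_self : ∀ i j, c i j (E i j) = 1
  idem : ∀ i, E i i * E i i = E i i
  orth : ∀ i j, i ≠ j → E i i * E j j = 0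
  rnorm_le : ∀ (n : ℕ) (ε : ℕ → ℝ), (∀ i, |ε i| ≤ 1) →
    rnorm ((∑ i ∈ Finset.range n, ε i • E i i : LrAlg X) : X →L[ℝ] X) ≤ 1

/-- `T` is majorized by a positive linear map. -/
def IsMajorized (T : LrAlg X →ₗ[ℝ] V →L[ℝ] ℝ) : Prop :=
  ∃ P : LrAlg X →ₗ[ℝ] V →L[ℝ] ℝ, ∀ a : LrAlg X, IsPosOp (a : X →L[ℝ] X) →
    dualLe 0 (P a) ∧ dualLe (T a) (P a)

theorem IsMajorized.add {S T : LrAlg X →ₗ[ℝ] V →L[ℝ] ℝ} (hS : IsMajorized S)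
    (hT : IsMajorized T) : IsMajorized (S + T) := by
  obtain ⟨P, hP⟩ := hS
  obtain ⟨Q, hQ⟩ := hT
  exact ⟨P + Q, fun a ha => ⟨fun y hy => add_nonneg ((hP a ha).1 y hy) ((hQ a ha).1 y hy),
    fun y hy => add_le_add ((hP a ha).2 y hy) ((hQ a ha).2 y hy)⟩⟩

/-- The linear map `a ↦ f ∘ m a`. -/
noncomputable def compAction (f : V →L[ℝ] ℝ) (m : LrAlg X →ₗ[ℝ] V →L[ℝ] V) :
    LrAlg X →ₗ[ℝ] V →L[ℝ] ℝ where
  toFun a := f ∘L m a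
  map_add' a b := by ext y; simp
  map_smul' t a := by ext y; simp

theorem isMajorized_compAction (f : V →L[ℝ] ℝ) {m : LrAlg X →ₗ[ℝ] V →L[ℝ] V}
    (hm : ∀ a : LrAlg X, IsPosOp (a : X →L[ℝ] X) → ∀ y, 0 ≤ y → 0 ≤ m a y) :
    IsMajorized (compAction f m) := by
  obtain ⟨g, hg0, hfg, -⟩ := exists_functional_posPart f
  exact ⟨compAction g m, fun a ha => ⟨fun y hy => hg0 _ (hm a ha y hy),
    fun y hy => hfg _ (hm a ha y hy)⟩⟩

variable {l r : LrAlg X →ₗ[ℝ] V →L[ℝ] V} {K : ℝ} {D : LrAlg X →ₗ[ℝ] V →L[ℝ] ℝ}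
  {E : ℕ → ℕ → LrAlg X} {c : ℕ → ℕ → LrAlg X →ₗ[ℝ] ℝ}

/-- The averaging functionals of a derivation over the diagonal sign groups are uniformly
bounded. -/
theorem abs_sum_diag_le (hV : IsLrModule l r K) (hE : IsMatrixUnits E c) {C : ℝ} (hC : 0 ≤ C)
    (hD : ∀ a y, |D a y| ≤ C * rnorm (a : X →L[ℝ] X) * ‖y‖) (n : ℕ) (y : V) :
    |∑ i ∈ Finset.range n, D (E i i) (l (E i i) y)| ≤ C * K * ‖y‖ := by
  have key : ∀ z : V, ∑ i ∈ Finset.range n, D (E i i) (l (E i i) z) ≤ C * K * ‖z‖ := by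
    intro z
    obtain ⟨ε, hε, h⟩ := exists_signs_sum_diag_le (Finset.range n)
      fun i j => D (E i i) (l (E j j) z)
    refine h.trans ?_
    set g : LrAlg X := ∑ i ∈ Finset.range n, ε i • E i i with hg
    have hgn : rnorm (g : X →L[ℝ] X) ≤ 1 := hE.rnorm_le n ε fun i => by
      rcases hε i with h | h <;> simp [h]
    have h1 : ∑ i ∈ Finset.range n, ∑ j ∈ Finset.range n, ε i * ε j * D (E i i) (l (E j j) z)
        = D g (l g z) := by
      simp only [hg, map_sum, map_smul, sum_apply,
        smul_apply, smul_eq_mul, Finset.mul_sum]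
      rw [Finset.sum_comm]
      exact Finset.sum_congr rfl fun i _ => Finset.sum_congr rfl fun j _ => by ring
    rw [h1]
    have h2 : ‖l g z‖ ≤ K * ‖z‖ := (hV.norm_l_le g z).trans (by
      have := mul_le_mul_of_nonneg_left hgn hV.nonneg
      rw [mul_one] at this
      gcongr)
    calc D g (l g z) ≤ C * rnorm (g : X →L[ℝ] X) * ‖l g z‖ := (le_abs_self _).trans (hD _ _)
      _ ≤ C * 1 * (K * ‖z‖) := by gcongr
      _ = C * K * ‖z‖ := by ring
  refine abs_le.2 ⟨?_, key y⟩
  have := key (-y)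
  simp only [map_neg, Finset.sum_neg_distrib, norm_neg] at this
  linarith

/-- Up to an inner derivation, a bounded derivation vanishes on the diagonal matrix units. -/
theorem exists_inner_on_diag (hV : IsLrModule l r K) (hE : IsMatrixUnits E c)
    (hD : IsDualDerivation l r D) (U : Ultrafilter ℕ) (hU : (U : Filter ℕ) ≤ atTop)
    (hl : ∀ (f : V →L[ℝ] ℝ) y,
      Tendsto (fun n => f (l (∑ i ∈ Finset.range n, E i i) y)) U (𝓝 (f (l 1 y)))) :
    ∃ ξ : V →L[ℝ] ℝ, ∀ k y, D (E k k) (l 1 y) = ξ (l (E k k) y) - ξ (r (E k k) y) := by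
  obtain ⟨C, hC, hDC⟩ := hD.bound
  obtain ⟨ξ, hξ⟩ := exists_weak_limit U
    (fun n => ∑ i ∈ Finset.range n, D (E i i) ∘L l (E i i)) (C := C * K) (fun n y => by
      simpa using abs_sum_diag_le hV hE hC hDC n y)
  refine ⟨ξ, fun k y => ?_⟩
  refine tendsto_nhds_unique (hl (D (E k k)) y)
    (((hξ (l (E k k) y)).sub (hξ (r (E k k) y))).congr' ?_)
  refine hU ((eventually_gt_atTop k).mono fun n hn => ?_)
  simp only [sum_apply, ContinuousLinearMap.comp_apply, map_sum]
  have h1 : ∀ i, l (E i i) (l (E k k) y) = if i = k then l (E k k) y else 0 := by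
    intro i
    rw [← hV.l_mul]
    split_ifs with h
    · rw [h, hE.idem]
    · rw [hE.orth i k h]; simp
  have h2 : ∀ i, D (E i i) (l (E i i) (r (E k k) y))
      = (if i = k then D (E k k) (l (E k k) y) else 0) - D (E k k) (l (E i i) y) := by
    intro i
    have := hD.map_mul (E k k) (E i i) (l (E i i) y)
    rw [← hV.l_mul, hE.idem] at this
    rw [hV.l_r]
    split_ifs with h
    · subst h
      rw [hE.idem] at this
      linarith
    · rw [hE.orth k i (Ne.symm h)] at this
      simp only [map_zero, zero_apply] at this
      linarith
  simp only [h1, h2, Finset.sum_sub_distrib]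
  have h3 : ∑ i ∈ Finset.range n, D (E i i) (if i = k then l (E k k) y else 0)
      = ∑ i ∈ Finset.range n, if i = k then D (E k k) (l (E k k) y) else 0 :=
    Finset.sum_congr rfl fun i _ => by split_ifs with h <;> simp [h]
  rw [h3]
  ring

/-- Compressing a derivation that vanishes on the diagonal matrix units. -/
theorem corner_eq (hV : IsLrModule l r K) (hE : IsMatrixUnits E c)
    (hD : IsDualDerivation l r D) (hdiag : ∀ k y, D (E k k) (l 1 y) = 0)
    (a : LrAlg X) (i j : ℕ) (y : V) :
    D a (l (E j j) (r (E i i) y)) = c i j a * D (E i j) (l 1 y) := by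
  have h1 : D (E i i * (a * E j j)) (l 1 y) = c i j a * D (E i j) (l 1 y) := by
    rw [hE.coeff, map_smul]; rfl
  have hl1 : ∀ b z, l b (l 1 z) = l 1 (l b z) := fun b z => by
    rw [← hV.l_mul, ← hV.l_mul, mul_one, one_mul]
  have hl1' : ∀ b z, l 1 (l b z) = l b z := fun b z => by rw [← hV.l_mul, one_mul]
  rw [hD.map_mul, hD.map_mul, ← hV.l_r, ← hV.l_r, hl1, hl1, hdiag, hdiag, hl1'] at h1
  linarith

/-- The compression of such a derivation to corners is majorized by a positive map. -/
theorem isMajorized_compression (hV : IsLrModule l r K) (hE : IsMatrixUnits E c)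
    (hD : IsDualDerivation l r D) (hdiag : ∀ k y, D (E k k) (l 1 y) = 0)
    (U : Ultrafilter ℕ)
    (hl : ∀ (f : V →L[ℝ] ℝ) y,
      Tendsto (fun n => f (l (∑ i ∈ Finset.range n, E i i) y)) U (𝓝 (f (l 1 y))))
    (hr : ∀ (f : V →L[ℝ] ℝ) y,
      Tendsto (fun n => f (r (∑ i ∈ Finset.range n, E i i) y)) U (𝓝 (f (r 1 y))))
    (T : LrAlg X →ₗ[ℝ] V →L[ℝ] ℝ) (hT : ∀ a y, T a y = D a (l 1 (r 1 y))) :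
    IsMajorized T := by
  obtain ⟨C, hC, hDC⟩ := hD.bound
  set S : ℕ → ℕ → V →L[ℝ] V := fun i j => l (E j j) ∘L r (E i i) with hS
  have hSpos : ∀ i j y, 0 ≤ y → 0 ≤ S i j y := fun i j y hy =>
    hV.l_nonneg _ (hE.pos j j) _ (hV.r_nonneg _ (hE.pos i i) _ hy)
  have hSS : ∀ i j y, S i j (S i j y) = S i j y := fun i j y => by
    change l (E j j) (r (E i i) (l (E j j) (r (E i i) y))) = l (E j j) (r (E i i) y)
    rw [← hV.l_r, ← hV.l_mul, hE.idem, ← hV.r_mul, hE.idem]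
  set d : ℕ → ℕ → V →L[ℝ] ℝ := fun i j => D (E i j) ∘L l 1 with hd
  have hcorner : ∀ a i j y, D a (S i j y) = c i j a * d i j y := fun a i j y =>
    corner_eq hV hE hD hdiag a i j y
  have hdS : ∀ i j y, d i j (S i j y) = d i j y := fun i j y => by
    have h1 := hcorner (E i j) i j (S i j y)
    have h2 := hcorner (E i j) i j y
    rw [hSS, h2, hE.coeff_self] at h1
    linarith
  choose g hg0 hdg hgw using fun i j => exists_functional_posPart (d i j)
  let P : ℕ × ℕ → LrAlg X → V →L[ℝ] ℝ := fun p a =>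
    ∑ i ∈ Finset.range p.1, ∑ j ∈ Finset.range p.2, c i j a • (g i j ∘L S i j)
  have hPapp : ∀ p a y, P p a y
      = ∑ i ∈ Finset.range p.1, ∑ j ∈ Finset.range p.2, c i j a * g i j (S i j y) := by
    intro p a y
    simp [P, sum_apply]
  have hsum : ∀ (p : ℕ × ℕ) y, ∑ i ∈ Finset.range p.1, ∑ j ∈ Finset.range p.2, S i j y
      = l (∑ j ∈ Finset.range p.2, E j j) (r (∑ i ∈ Finset.range p.1, E i i) y) := by
    intro p y
    simp only [hS, map_sum, sum_apply, ContinuousLinearMap.comp_apply]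
  have hen : ∀ n, rnorm ((∑ i ∈ Finset.range n, E i i : LrAlg X) : X →L[ℝ] X) ≤ 1 := fun n => by
    simpa using hE.rnorm_le n (fun _ => 1) (by simp)
  have hsumnorm : ∀ (p : ℕ × ℕ) y,
      ‖∑ i ∈ Finset.range p.1, ∑ j ∈ Finset.range p.2, S i j y‖ ≤ K * (K * ‖y‖) := by
    intro p y
    have hK : ∀ n, K * rnorm ((∑ i ∈ Finset.range n, E i i : LrAlg X) : X →L[ℝ] X) ≤ K :=
      fun n => by simpa using mul_le_mul_of_nonneg_left (hen n) hV.nonneg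
    rw [hsum]
    refine (hV.norm_l_le _ _).trans (mul_le_mul (hK _) ?_ (norm_nonneg _) hV.nonneg)
    exact (hV.norm_r_le _ _).trans (mul_le_mul_of_nonneg_right (hK _) (norm_nonneg _))
  have hPpos : ∀ p (a : LrAlg X), IsPosOp (a : X →L[ℝ] X) → ∀ y, 0 ≤ y → 0 ≤ P p a y := by
    intro p a ha y hy
    rw [hPapp]
    exact Finset.sum_nonneg fun i _ => Finset.sum_nonneg fun j _ =>
      mul_nonneg (hE.coeff_nonneg i j a ha) (by simpa using hg0 i j _ (hSpos i j y hy))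
  have hPle : ∀ p (a : LrAlg X), IsPosOp (a : X →L[ℝ] X) → ∀ y, 0 ≤ y →
      P p a y ≤ C * rnorm (a : X →L[ℝ] X) * (K * (K * ‖y‖)) := by
    intro p a ha y hy
    set σ := ∑ i ∈ Finset.range p.1, ∑ j ∈ Finset.range p.2, c i j a with hσ
    have hσ0 : 0 ≤ σ := Finset.sum_nonneg fun i _ => Finset.sum_nonneg fun j _ =>
      hE.coeff_nonneg i j a ha
    refine le_of_forall_pos_le_add fun ε hε => ?_
    choose w hw0 hwle hw using fun i j =>
      hgw i j (S i j y) (hSpos i j y hy) (ε / (σ + 1)) (by positivity)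
    set W := ∑ i ∈ Finset.range p.1, ∑ j ∈ Finset.range p.2, S i j (w i j) with hW
    have hWnorm : ‖W‖ ≤ K * (K * ‖y‖) := by
      refine (norm_le_norm_of_nonneg_le ?_ ?_).trans (hsumnorm p y)
      · exact Finset.sum_nonneg fun i _ => Finset.sum_nonneg fun j _ => hSpos i j _ (hw0 i j)
      · refine Finset.sum_le_sum fun i _ => Finset.sum_le_sum fun j _ => ?_
        rw [← hSS i j y, ← sub_nonneg, ← map_sub]
        exact hSpos i j _ (sub_nonneg.2 (hwle i j))
    have hDW : D a W = ∑ i ∈ Finset.range p.1, ∑ j ∈ Finset.range p.2, c i j a * d i j (w i j) := by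
      simp only [hW, map_sum, hcorner]
    have h1 : P p a y ≤ D a W + σ * (ε / (σ + 1)) := by
      rw [hPapp, hDW, hσ, Finset.sum_mul, ← Finset.sum_add_distrib]
      refine Finset.sum_le_sum fun i _ => ?_
      rw [Finset.sum_mul, ← Finset.sum_add_distrib]
      refine Finset.sum_le_sum fun j _ => ?_
      rw [← mul_add]
      exact mul_le_mul_of_nonneg_left (hw i j) (hE.coeff_nonneg i j a ha)
    have h2 : σ * (ε / (σ + 1)) ≤ ε := by
      rw [mul_div_assoc', div_le_iff₀ (by positivity)]
      nlinarith
    have h3 : D a W ≤ C * rnorm (a : X →L[ℝ] X) * (K * (K * ‖y‖)) :=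
      ((le_abs_self _).trans (hDC a W)).trans
        (mul_le_mul_of_nonneg_left hWnorm (mul_nonneg hC (rnorm_nonneg _)))
    linarith
  have hPadd : ∀ p a b, P p (a + b) = P p a + P p b := by
    intro p a b
    simp only [P, map_add, add_smul, Finset.sum_add_distrib]
  have hPsmul : ∀ p (t : ℝ) a, P p (t • a) = t • P p a := by
    intro p t a
    simp only [P, map_smul, smul_eq_mul, mul_smul, Finset.smul_sum]
  have : ((U : Filter ℕ).curry (U : Filter ℕ)).NeBot := by
    refine ⟨fun h => ?_⟩
    have h1 : ∀ᶠ _p in (U : Filter ℕ).curry (U : Filter ℕ), False := by rw [h]; trivial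
    obtain ⟨n, hn⟩ := (eventually_curry_iff.1 h1).exists
    exact hn.exists.elim fun _ => id
  let W : Ultrafilter (ℕ × ℕ) := Ultrafilter.of ((U : Filter ℕ).curry (U : Filter ℕ))
  have hlimpos : ∀ a : LrAlg X, IsPosOp (a : X →L[ℝ] X) →
      ∃ G : V →L[ℝ] ℝ, ∀ y, Tendsto (fun p => P p a y) W (𝓝 (G y)) := by
    intro a ha
    refine exists_weak_limit W (fun p => P p a) fun p y =>
      abs_apply_le_of_nonneg_bound (P p a) (C := C * rnorm (a : X →L[ℝ] X) * (K * K))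
        (fun z hz => ?_)
        (mul_nonneg (mul_nonneg hC (rnorm_nonneg _)) (mul_nonneg hV.nonneg hV.nonneg)) y
    rw [abs_of_nonneg (hPpos p a ha z hz)]
    exact (hPle p a ha z hz).trans_eq (by ring)
  have hlim : ∀ a : LrAlg X,
      ∃ G : V →L[ℝ] ℝ, ∀ y, Tendsto (fun p => P p a y) W (𝓝 (G y)) := by
    intro a
    obtain ⟨a₁, a₂, h₁, h₂, ha⟩ := mem_LrSet_iff.1 a.2
    obtain ⟨G₁, hG₁⟩ := hlimpos ⟨a₁, h₁.mem_LrSet⟩ h₁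
    obtain ⟨G₂, hG₂⟩ := hlimpos ⟨a₂, h₂.mem_LrSet⟩ h₂
    refine ⟨G₁ - G₂, fun y => ((hG₁ y).sub (hG₂ y)).congr fun p => ?_⟩
    have h : a + ⟨a₂, h₂.mem_LrSet⟩ = ⟨a₁, h₁.mem_LrSet⟩ := Subtype.ext (by simp [ha])
    rw [← h, hPadd, add_apply, add_sub_cancel_right]
  choose Q hQ using hlim
  let Q' : LrAlg X →ₗ[ℝ] V →L[ℝ] ℝ :=
    { toFun := Q
      map_add' := fun a b => by
        ext y
        refine tendsto_nhds_unique (hQ (a + b) y) (((hQ a y).add (hQ b y)).congr fun p => ?_)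
        rw [hPadd, add_apply]
      map_smul' := fun t a => by
        ext y
        refine tendsto_nhds_unique (hQ (t • a) y) (((hQ a y).const_smul t).congr fun p => ?_)
        rw [hPsmul, smul_apply] }
  refine ⟨Q', fun a ha => ⟨fun y hy => ?_, fun y hy => ?_⟩⟩
  · exact ge_of_tendsto' (hQ a y) fun p => hPpos p a ha y hy
  · have hle : ∀ p : ℕ × ℕ, D a (l (∑ j ∈ Finset.range p.2, E j j)
        (r (∑ i ∈ Finset.range p.1, E i i) y)) ≤ P p a y := by
      intro p
      rw [← hsum, hPapp, map_sum]
      refine Finset.sum_le_sum fun i _ => ?_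
      rw [map_sum]
      refine Finset.sum_le_sum fun j _ => ?_
      rw [hcorner, ← hdS]
      exact mul_le_mul_of_nonneg_left (hdg i j _ (hSpos i j y hy)) (hE.coeff_nonneg i j a ha)
    have hiter : Tendsto (fun p : ℕ × ℕ => D a (l (∑ j ∈ Finset.range p.2, E j j)
        (r (∑ i ∈ Finset.range p.1, E i i) y))) ((U : Filter ℕ).curry (U : Filter ℕ))
        (𝓝 (T a y)) := by
      rw [hT, tendsto_nhds]
      intro s hs hmem
      refine eventually_curry_iff.2 ?_
      refine ((hr (D a ∘L l 1) y).eventually_mem (hs.mem_nhds hmem)).mono fun n hn => ?_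
      exact (hl (D a) _).eventually_mem (hs.mem_nhds hn)
    exact le_of_tendsto_of_tendsto' (hiter.mono_left (Ultrafilter.of_le _)) (hQ a y) hle

end Derivation

section DerivationRegular

variable {X V : Type*} [NormedAddCommGroup X] [Lattice X] [HasSolidNorm X]
  [IsOrderedAddMonoid X] [NormedSpace ℝ X]
  [NormedAddCommGroup V] [Lattice V] [HasSolidNorm V] [IsOrderedAddMonoid V] [NormedSpace ℝ V]
  {l r : LrAlg X →ₗ[ℝ] V →L[ℝ] V} {K : ℝ} {D : LrAlg X →ₗ[ℝ] V →L[ℝ] ℝ}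
  {E : ℕ → ℕ → LrAlg X} {c : ℕ → ℕ → LrAlg X →ₗ[ℝ] ℝ}

/-- Subtracting an inner derivation from a derivation. -/
theorem IsDualDerivation.sub_inner (hV : IsLrModule l r K) (hD : IsDualDerivation l r D)
    (ξ : V →L[ℝ] ℝ) :
    IsDualDerivation l r (D + compAction (-ξ) l + compAction ξ r) := by
  obtain ⟨C, hC, hDC⟩ := hD.bound
  refine ⟨fun a b y => ?_, C + 2 * (‖ξ‖ * K), ?_, fun a y => ?_⟩
  · have := hD.map_mul a b y
    simp only [compAction, LinearMap.add_apply, LinearMap.coe_mk, AddHom.coe_mk, add_apply,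
      ContinuousLinearMap.comp_apply, neg_apply, hV.l_mul, hV.r_mul, hV.l_r, this]
    ring
  · have := hV.nonneg
    positivity
  · have h1 : |ξ (l a y)| ≤ ‖ξ‖ * (K * rnorm (a : X →L[ℝ] X) * ‖y‖) :=
      (ξ.le_opNorm _).trans (mul_le_mul_of_nonneg_left (hV.norm_l_le a y) (norm_nonneg _))
    have h2 : |ξ (r a y)| ≤ ‖ξ‖ * (K * rnorm (a : X →L[ℝ] X) * ‖y‖) :=
      (ξ.le_opNorm _).trans (mul_le_mul_of_nonneg_left (hV.norm_r_le a y) (norm_nonneg _))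
    have h3 := hDC a y
    change |D a y + -ξ (l a y) + ξ (r a y)| ≤ _
    have h4 := abs_add_three (D a y) (-ξ (l a y)) (ξ (r a y))
    rw [abs_neg] at h4
    linarith

/-- Every bounded derivation into the dual module is majorized by a positive map. -/
theorem IsDualDerivation.isMajorized (hV : IsLrModule l r K) (hE : IsMatrixUnits E c)
    (hD : IsDualDerivation l r D) (U : Ultrafilter ℕ) (hU : (U : Filter ℕ) ≤ atTop)
    (hl : ∀ (f : V →L[ℝ] ℝ) y,
      Tendsto (fun n => f (l (∑ i ∈ Finset.range n, E i i) y)) U (𝓝 (f (l 1 y))))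
    (hr : ∀ (f : V →L[ℝ] ℝ) y,
      Tendsto (fun n => f (r (∑ i ∈ Finset.range n, E i i) y)) U (𝓝 (f (r 1 y)))) :
    IsMajorized D := by
  obtain ⟨ξ, hξ⟩ := exists_inner_on_diag hV hE hD U hU hl
  set δ := D + compAction (-ξ) l + compAction ξ r with hδdef
  have hδ : IsDualDerivation l r δ := hD.sub_inner hV ξ
  have hl1 : ∀ b z, l b (l 1 z) = l b z := fun b z => by rw [← hV.l_mul, mul_one]
  have hr1 : ∀ b z, r b (r 1 z) = r b z := fun b z => by rw [← hV.r_mul, one_mul]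
  have hδapp : ∀ a y, δ a y = D a y + -ξ (l a y) + ξ (r a y) := fun a y => rfl
  have hdiag : ∀ k y, δ (E k k) (l 1 y) = 0 := fun k y => by
    have h1 : ξ (r (E k k) (l 1 y)) = ξ (r (E k k) y) := by
      have h2 := hξ k (l 1 y)
      rw [hl1, hl1, hξ k y] at h2
      linarith
    rw [hδapp, hξ, hl1, h1]
    ring
  let T : LrAlg X →ₗ[ℝ] V →L[ℝ] ℝ :=
    { toFun := fun a => δ a ∘L (l 1 ∘L r 1)
      map_add' := fun a b => by ext y; simp
      map_smul' := fun t a => by ext y; simp }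
  have hT : ∀ a y, T a y = δ a (l 1 (r 1 y)) := fun a y => rfl
  have hTmaj := isMajorized_compression hV hE hδ hdiag U hl hr T hT
  have hdecomp : D = T + compAction (δ 1 + ξ) l + compAction (δ 1 + -ξ) r := by
    ext a y
    have h1 := hδ.map_mul 1 a y
    have h2 := hδ.map_mul a 1 (r 1 y)
    rw [one_mul] at h1
    rw [mul_one, hr1, ← hT] at h2
    change D a y = T a y + (δ 1 (l a y) + ξ (l a y)) + (δ 1 (r a y) + -ξ (r a y))
    rw [h2, hδapp] at h1
    linarith
  rw [hdecomp]
  exact (hTmaj.add (isMajorized_compAction _ hV.l_nonneg)).add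
    (isMajorized_compAction _ hV.r_nonneg)

/-- An action of ℒʳ(X) given by a map that is bilinear and bounded on regular operators. -/
noncomputable def lrAction (m : (X →L[ℝ] X) → V → V) (M : ℝ)
    (hadd : ∀ a ∈ LrSet X, ∀ y₁ y₂ : V, m a (y₁ + y₂) = m a y₁ + m a y₂)
    (hlin : ∀ a ∈ LrSet X, ∀ b ∈ LrSet X, ∀ (s t : ℝ) (y : V),
      m (s • a + t • b) y = s • m a y + t • m b y)
    (hbd : ∀ a ∈ LrSet X, ∀ y : V, ‖m a y‖ ≤ M * rnorm a * ‖y‖) :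
    LrAlg X →ₗ[ℝ] V →L[ℝ] V where
  toFun a := (AddMonoidHom.mk' (m a) (hadd a a.2)).toRealLinearMap
    (AddMonoidHomClass.continuous_of_bound _ (M * rnorm (a : X →L[ℝ] X)) (hbd a a.2))
  map_add' a b := by
    ext y
    simpa using hlin a a.2 b b.2 1 1 y
  map_smul' t a := by
    ext y
    simpa using hlin a a.2 a a.2 t 0 y

/-- Order convergence of the partial sums along the cone gives weak convergence of the action. -/
theorem tendsto_action_partialSum {m : LrAlg X →ₗ[ℝ] V →L[ℝ] V} {B : ℝ} {e : ℕ → LrAlg X}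
    (U : Ultrafilter ℕ) (hU : (U : Filter ℕ) ≤ atTop)
    (hm : ∀ a : LrAlg X, IsPosOp (a : X →L[ℝ] X) → ∀ y, 0 ≤ y → 0 ≤ m a y)
    (hb : ∀ n y, ‖m (e n) y‖ ≤ B * ‖y‖)
    (hmono : ∀ n k, n ≤ k → IsPosOp ((e k - e n : LrAlg X) : X →L[ℝ] X))
    (hlub : ∀ f : V →L[ℝ] ℝ, dualLe 0 f →
      dualIsLUB (Set.range fun n => f ∘L m (e n)) (f ∘L m 1))
    (f : V →L[ℝ] ℝ) (y : V) :
    Tendsto (fun n => f (m (e n) y)) U (𝓝 (f (m 1 y))) := by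
  have hpos : ∀ g : V →L[ℝ] ℝ, dualLe 0 g →
      Tendsto (fun n => g (m (e n) y)) U (𝓝 (g (m 1 y))) := by
    intro g hg
    refine tendsto_of_monotone_dualIsLUB U hU (fun n => g ∘L m (e n)) (g ∘L m 1)
      (C := ‖g‖ * B) (fun n z => ?_) (fun n k hnk z hz => ?_) (hlub g hg) y
    · rw [mul_assoc]
      exact (g.le_opNorm _).trans (mul_le_mul_of_nonneg_left (hb n z) (norm_nonneg g))
    · have h : (0 : ℝ) ≤ g (m (e k - e n) z) := hg _ (hm _ (hmono n k hnk) z hz)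
      rw [map_sub, sub_apply, map_sub] at h
      exact sub_nonneg.1 h
  obtain ⟨g, hg, hfg, -⟩ := exists_functional_posPart f
  have h := (hpos g hg).sub (hpos (g - f) fun z hz => sub_nonneg.2 (hfg z hz))
  simpa using h

end DerivationRegular

theorem Lr_derivation_regular
    {X 𝔛 : Type*} [NormedAddCommGroup X] [Lattice X] [HasSolidNorm X] [IsOrderedAddMonoid X] [NormedSpace ℝ X] [CompleteSpace X]
    [NormedAddCommGroup 𝔛] [Lattice 𝔛] [HasSolidNorm 𝔛] [IsOrderedAddMonoid 𝔛] [NormedSpace ℝ 𝔛] [CompleteSpace 𝔛]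
    -- X = (⊕ᵢ Xᵢ)_𝐞 is order complete:
    (hXoc : ∀ S : Set X, S.Nonempty → BddAbove S → ∃ b, IsLUB S b)
    (μ : ℝ) (hμ : 1 ≤ μ)
    -- (x i) is a shrinking basis for X satisfying (⋆) with constant μ in each summand:
    (x : ℕ → X) (xs : ℕ → X →L[ℝ] ℝ)
    (hstar : StarSummandBasis μ x)
    (hbi : ∀ i j, xs i (x j) = if i = j then (1 : ℝ) else 0)
    (hbasis : ∀ y : X, Tendsto (fun n => ∑ i ∈ Finset.range n, xs i y • x i) atTop (𝓝 y))
    (hshrink : ∀ l : X →L[ℝ] ℝ,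
      Tendsto (fun n => ‖l - ∑ i ∈ Finset.range n, l (x i) • xs i‖) atTop (𝓝 0))
    -- 𝔛 is a Banach lattice ℒʳ(X)-module, with actions Ml, Mr and constant M:
    (Ml Mr : (X →L[ℝ] X) → 𝔛 → 𝔛) (M : ℝ)
    (hMladd : ∀ a ∈ LrSet X, ∀ y₁ y₂ : 𝔛, Ml a (y₁ + y₂) = Ml a y₁ + Ml a y₂)
    (hMradd : ∀ a ∈ LrSet X, ∀ y₁ y₂ : 𝔛, Mr a (y₁ + y₂) = Mr a y₁ + Mr a y₂)
    (hMllin : ∀ a ∈ LrSet X, ∀ b ∈ LrSet X, ∀ (s t : ℝ) (y : 𝔛),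
      Ml (s • a + t • b) y = s • Ml a y + t • Ml b y)
    (hMrlin : ∀ a ∈ LrSet X, ∀ b ∈ LrSet X, ∀ (s t : ℝ) (y : 𝔛),
      Mr (s • a + t • b) y = s • Mr a y + t • Mr b y)
    (hMlmul : ∀ a ∈ LrSet X, ∀ b ∈ LrSet X, ∀ y : 𝔛, Ml (a ∘L b) y = Ml a (Ml b y))
    (hMrmul : ∀ a ∈ LrSet X, ∀ b ∈ LrSet X, ∀ y : 𝔛, Mr (a ∘L b) y = Mr b (Mr a y))
    (hMlr : ∀ a ∈ LrSet X, ∀ b ∈ LrSet X, ∀ y : 𝔛, Ml a (Mr b y) = Mr b (Ml a y))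
    (hMpos : ∀ a ∈ LrSet X, IsPosOp a → ∀ y : 𝔛, 0 ≤ y → 0 ≤ Ml a y ∧ 0 ≤ Mr a y)
    (hMbd : ∀ a ∈ LrSet X, ∀ y : 𝔛,
      ‖Ml a y‖ ≤ M * rnorm a * ‖y‖ ∧ ‖Mr a y‖ ≤ M * rnorm a * ‖y‖)
    -- dual module products on 𝔛′ := 𝔛 →L[ℝ] ℝ :
    (DL DR : (X →L[ℝ] X) → (𝔛 →L[ℝ] ℝ) → (𝔛 →L[ℝ] ℝ))
    (hDL : ∀ a ∈ LrSet X, ∀ (x' : 𝔛 →L[ℝ] ℝ) (y : 𝔛), DL a x' y = x' (Mr a y))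
    (hDR : ∀ a ∈ LrSet X, ∀ (x' : 𝔛 →L[ℝ] ℝ) (y : 𝔛), DR a x' y = x' (Ml a y))
    -- sup_n e_n·x′ = e·x′ and sup_n x′·e_n = x′·e for x′ ∈ 𝔛′₊ (e = id_X):
    (hsup : ∀ x' : 𝔛 →L[ℝ] ℝ, dualLe 0 x' →
      dualIsLUB (Set.range fun n =>
        DL (∑ i ∈ Finset.range n, (xs i).smulRight (x i)) x')
        (DL (ContinuousLinearMap.id ℝ X) x') ∧
      dualIsLUB (Set.range fun n =>
        DR (∑ i ∈ Finset.range n, (xs i).smulRight (x i)) x')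
        (DR (ContinuousLinearMap.id ℝ X) x'))
    -- either 𝔛 contains no complemented copy of ℓ₁, or X is reflexive and all the
    -- corner spaces q_i·𝔛′·q_j are finite dimensional:
    (hcases :
      (¬ HasComplementedL1 𝔛) ∨
      (Function.Surjective (NormedSpace.inclusionInDoubleDual ℝ X) ∧
        ∀ i j : ℕ, ∃ (n : ℕ) (b : Fin n → (𝔛 →L[ℝ] ℝ)),
          ∀ ξ : 𝔛 →L[ℝ] ℝ,
            (∃ x' : 𝔛 →L[ℝ] ℝ,
              ξ = DL ((xs i).smulRight (x i)) (DR ((xs j).smulRight (x j)) x')) →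
            ∃ c : Fin n → ℝ, ξ = ∑ t, c t • b t))
    -- D is a bounded derivation from ℒʳ(X) to 𝔛′:
    (D : (X →L[ℝ] X) → (𝔛 →L[ℝ] ℝ))
    (hDadd : ∀ a ∈ LrSet X, ∀ b ∈ LrSet X, D (a + b) = D a + D b)
    (hDsmul : ∀ (r : ℝ), ∀ a ∈ LrSet X, D (r • a) = r • D a)
    (hDder : ∀ a ∈ LrSet X, ∀ b ∈ LrSet X, D (a ∘L b) = DL a (D b) + DR b (D a))
    (hDbdd : ∃ C : ℝ, ∀ a ∈ LrSet X, ‖D a‖ ≤ C * rnorm a) :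
    RegularDerivOn (LrSet X) D := by
  obtain ⟨I, ψ, -, -, -, hatom, -, -, -⟩ := hstar
  obtain ⟨C, hC⟩ := hDbdd
  have hMbd' : ∀ a ∈ LrSet X, ∀ y : 𝔛,
      ‖Ml a y‖ ≤ |M| * rnorm a * ‖y‖ ∧ ‖Mr a y‖ ≤ |M| * rnorm a * ‖y‖ := by
    intro a ha y
    have h : M * rnorm a * ‖y‖ ≤ |M| * rnorm a * ‖y‖ :=
      mul_le_mul_of_nonneg_right (mul_le_mul_of_nonneg_right (le_abs_self M) (rnorm_nonneg a))
        (norm_nonneg y)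
    exact ⟨(hMbd a ha y).1.trans h, (hMbd a ha y).2.trans h⟩
  let l := lrAction Ml |M| hMladd hMllin fun a ha y => (hMbd' a ha y).1
  let r := lrAction Mr |M| hMradd hMrlin fun a ha y => (hMbd' a ha y).2
  have hV : IsLrModule l r |M| :=
    { l_mul := fun a b y => hMlmul a a.2 b b.2 y
      r_mul := fun a b y => hMrmul a a.2 b b.2 y
      l_r := fun a b y => hMlr a a.2 b b.2 y
      l_nonneg := fun a ha y hy => (hMpos a a.2 ha y hy).1
      r_nonneg := fun a ha y hy => (hMpos a a.2 ha y hy).2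
      norm_l_le := fun a y => (hMbd' a a.2 y).1
      norm_r_le := fun a y => (hMbd' a a.2 y).2
      nonneg := abs_nonneg M }
  let D' : LrAlg X →ₗ[ℝ] 𝔛 →L[ℝ] ℝ :=
    { toFun := fun a => D a
      map_add' := fun a b => hDadd a a.2 b b.2
      map_smul' := fun t a => hDsmul t a a.2 }
  have hD' : IsDualDerivation l r D' :=
    { map_mul := fun a b y => by
        change D ((a : X →L[ℝ] X) ∘L b) y = D b (Mr a y) + D a (Ml b y)
        rw [hDder a a.2 b b.2, add_apply, hDL a a.2, hDR b b.2]
      bound := ⟨|C|, abs_nonneg C, fun a y => by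
        refine ((D a).le_opNorm y).trans (mul_le_mul_of_nonneg_right ?_ (norm_nonneg y))
        exact (hC a a.2).trans (mul_le_mul_of_nonneg_right (le_abs_self C) (rnorm_nonneg _))⟩ }
  have hEpos := isPosOp_matUnit hatom hbi hbasis
  let E : ℕ → ℕ → LrAlg X := fun i j => ⟨matUnit x xs i j, (hEpos i j).mem_LrSet⟩
  let c : ℕ → ℕ → LrAlg X →ₗ[ℝ] ℝ := fun i j =>
    { toFun := fun a => xs i ((a : X →L[ℝ] X) (x j))
      map_add' := fun a b => by simp
      map_smul' := fun t a => by simp }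
  have hE : IsMatrixUnits E c :=
    { pos := hEpos
      coeff := fun i j a => Subtype.ext (matUnit_comp (a : X →L[ℝ] X) i i j j)
      coeff_nonneg := fun i j a ha =>
        coord_nonneg hatom hbi hbasis i (ha _ (hatom j).1.le)
      coeff_self := fun i j => by
        change xs i (xs j (x j) • x i) = 1
        simp [hbi]
      idem := fun i => Subtype.ext <| by
        have := matUnit_comp (x := x) (xs := xs) 1 i i i i
        simpa [hbi] using this
      orth := fun i j hij => Subtype.ext <| by
        have := matUnit_comp (x := x) (xs := xs) 1 i i j j
        simpa [hbi, hij] using this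
      rnorm_le := fun n ε hε => by
        have := rnorm_signed_sum_le hatom hbi hbasis n ε hε
        simpa [E] using this }
  let e : ℕ → LrAlg X := fun n => ∑ i ∈ Finset.range n, E i i
  have he : ∀ n, (e n : X →L[ℝ] X) = ∑ i ∈ Finset.range n, (xs i).smulRight (x i) := fun n => by
    simp [e, E, matUnit]
  have hrn : ∀ n, |M| * rnorm (e n : X →L[ℝ] X) ≤ |M| := fun n => by
    have := hE.rnorm_le n (fun _ => 1) (by simp)
    simp only [one_smul] at this
    exact (mul_le_mul_of_nonneg_left this (abs_nonneg M)).trans_eq (mul_one _)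
  have hmono : ∀ n k, n ≤ k → IsPosOp ((e k - e n : LrAlg X) : X →L[ℝ] X) := by
    intro n k hnk
    have h : e k - e n = ∑ i ∈ Finset.Ico n k, E i i := (Finset.sum_Ico_eq_sub _ hnk).symm
    rw [h, AddSubmonoidClass.coe_finsetSum]
    exact isPosOp_sum _ fun i _ => hEpos i i
  let U := Filter.hyperfilter ℕ
  have hU : (U : Filter ℕ) ≤ atTop := Nat.hyperfilter_le_atTop
  have hl := tendsto_action_partialSum (m := l) (e := e) U hU hV.l_nonneg
    (fun n y => (hV.norm_l_le _ _).trans (mul_le_mul_of_nonneg_right (hrn n) (norm_nonneg y)))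
    hmono fun f hf => by
      have h := (hsup f hf).2
      have h1 : (fun n => DR (∑ i ∈ Finset.range n, (xs i).smulRight (x i)) f)
          = fun n => f ∘L l (e n) := by
        funext n
        ext y
        rw [← he, hDR _ (e n).2]
        rfl
      have h2 : DR (ContinuousLinearMap.id ℝ X) f = f ∘L l 1 := by
        ext y
        exact hDR _ (1 : LrAlg X).2 f y
      rwa [h1, h2] at h
  have hr := tendsto_action_partialSum (m := r) (e := e) U hU hV.r_nonneg
    (fun n y => (hV.norm_r_le _ _).trans (mul_le_mul_of_nonneg_right (hrn n) (norm_nonneg y)))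
    hmono fun f hf => by
      have h := (hsup f hf).1
      have h1 : (fun n => DL (∑ i ∈ Finset.range n, (xs i).smulRight (x i)) f)
          = fun n => f ∘L r (e n) := by
        funext n
        ext y
        rw [← he, hDL _ (e n).2]
        rfl
      have h2 : DL (ContinuousLinearMap.id ℝ X) f = f ∘L r 1 := by
        ext y
        exact hDL _ (1 : LrAlg X).2 f y
      rwa [h1, h2] at h
  obtain ⟨P, hP⟩ := hD'.isMajorized hV hE U hU hl hr
  classical
  let extend : (LrAlg X →ₗ[ℝ] 𝔛 →L[ℝ] ℝ) → (X →L[ℝ] X) → 𝔛 →L[ℝ] ℝ := fun Q a =>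
    if h : a ∈ LrSet X then Q ⟨a, h⟩ else 0
  have hext : ∀ Q (a : LrAlg X), extend Q a = Q a := fun Q a => dif_pos a.2
  have hextlin : ∀ Q : LrAlg X →ₗ[ℝ] 𝔛 →L[ℝ] ℝ,
      (∀ a : LrAlg X, IsPosOp (a : X →L[ℝ] X) → dualLe 0 (Q a)) →
      (∀ a ∈ LrSet X, ∀ b ∈ LrSet X, extend Q (a + b) = extend Q a + extend Q b) ∧
      (∀ (t : ℝ), ∀ a ∈ LrSet X, extend Q (t • a) = t • extend Q a) ∧
      ∀ a ∈ LrSet X, IsPosOp a → dualLe 0 (extend Q a) := by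
    intro Q hQ
    refine ⟨fun a ha b hb => ?_, fun t a ha => ?_, fun a ha hpos => ?_⟩
    · have h := hext Q (⟨a, ha⟩ + ⟨b, hb⟩)
      rw [map_add, ← hext, ← hext] at h
      exact h
    · have h := hext Q (t • ⟨a, ha⟩)
      rw [map_smul, ← hext] at h
      exact h
    · rw [hext Q ⟨a, ha⟩]
      exact hQ _ hpos
  refine ⟨2, ![1, -1], ![extend P, extend (P - D')], fun t => ?_, fun a ha => ?_⟩
  · fin_cases t
    · exact hextlin P fun a ha => (hP a ha).1
    · exact hextlin (P - D') fun a ha y hy => sub_nonneg.2 ((hP a ha).2 y hy)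
  · have h1 := hext P ⟨a, ha⟩
    have h2 := hext (P - D') ⟨a, ha⟩
    simp only [Fin.sum_univ_two, Matrix.cons_val_zero, Matrix.cons_val_one, one_smul]
    change extend P a = _ at h1
    change extend (P - D') a = _ at h2
    rw [h1, h2, LinearMap.sub_apply]
    change D a = P ⟨a, ha⟩ + (-1 : ℝ) • (P ⟨a, ha⟩ - D a)
    module
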